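/- Let G be a group generated by a finite symmetric set S, acting faithfully and transitively on a set V with action graph Γ. If δ_Γ(R) and γ_Γ(R) are bounded above by polynomial functions of R, and L(R) ≤ R^α for some α ∈ (0, 1), then there is a constant C such that γ_G(R) ≤ exp(C·(log R)·R^α) for all R ≥ 2. -/

import Mathlib

noncomputable section

namespace ActionGrowth

variable {G V : Type} [Group G]

/-- The product in `G` of a word over the generating set `S`. -/
def wordProd (S : Set G) (w : List S) : G := (w.map (fun s => (s : G))).prod

/-- The (vertex set of the) ball of radius `R` centered at `v` in the graph of the
right action `act` of `G` on `V` with respect to the symmetric generating set `S`. -/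
def ball (act : V → G → V) (S : Set G) (v : V) (R : ℕ) : Set V :=
  {u | ∃ w : List S, w.length ≤ R ∧ act v (wordProd S w) = u}

/-- Graph distance in the graph of the action (for a symmetric generating set `S`). -/
def gdist (act : V → G → V) (S : Set G) (v u : V) : ℕ :=
  sInf {n | u ∈ ball act S v n}

/-- `R_w(v)`: the maximum over the prefixes `s₁ ⋯ s_i` of `w` of the distances
`d(v, v · s₁ ⋯ s_i)`, i.e. the minimal radius of a ball centered at `v`
containing the path labeled `w` starting at `v`. -/
def rad (act : V → G → V) (S : Set G) (w : List S) (v : V) : ℕ :=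
  (Finset.range (w.length + 1)).sup fun i => gdist act S v (act v (wordProd S (w.take i)))

/-- Isomorphism of the rooted labeled balls `(B_v(R), v)` and `(B_u(R), u)`:
a bijection of the balls sending root to root and preserving the labeled edges
of the spanned subgraphs. -/
def BallIso (act : V → G → V) (S : Set G) (R : ℕ) (v u : V) : Prop :=
  ∃ φ : V → V, Set.BijOn φ (ball act S v R) (ball act S u R) ∧ φ v = u ∧
    ∀ x ∈ ball act S v R, ∀ y ∈ ball act S v R, ∀ s : S,
      (act x (s : G) = y ↔ act (φ x) (s : G) = φ y)

/-- `δ_Γ(R)`: the number of isomorphism classes of rooted balls `(B_v(R), v)`. -/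
def ballTypes (act : V → G → V) (S : Set G) (R : ℕ) : ℕ :=
  Nat.card (Quot (BallIso act S R))

/-- `γ_Γ(R)`: the maximal number of vertices of a ball of radius `R` in `Γ`. -/
def graphGrowth (act : V → G → V) (S : Set G) (R : ℕ) : ℕ :=
  ⨆ v : V, Nat.card (ball act S v R)

/-- Isomorphism of the elements `(B_v(R_w(v)), v, v·w)` and `(B_u(R_w(u)), u, u·w)`
of the standard portrait of `w`: a bijection of the balls matching both roots and
preserving the labeled edges. -/
def PortraitRel (act : V → G → V) (S : Set G) (w : List S) (v u : V) : Prop :=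
  ∃ φ : V → V,
    Set.BijOn φ (ball act S v (rad act S w v)) (ball act S u (rad act S w u)) ∧
    φ v = u ∧ φ (act v (wordProd S w)) = act u (wordProd S w) ∧
    ∀ x ∈ ball act S v (rad act S w v), ∀ y ∈ ball act S v (rad act S w v), ∀ s : S,
      (act x (s : G) = y ↔ act (φ x) (s : G) = φ y)

/-- `#P_w`: the number of elements (isomorphism classes of bi-rooted balls)
of the standard portrait of the word `w`. -/
def portraitCard (act : V → G → V) (S : Set G) (w : List S) : ℕ :=
  Nat.card (Quot (PortraitRel act S w))

/-- The ball of radius `R` in the group `G` with respect to `S`: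
elements of word length at most `R`. -/
def ballG (S : Set G) (R : ℕ) : Set G :=
  {g | ∃ w : List S, w.length ≤ R ∧ wordProd S w = g}

/-- `γ_G(R)`: the growth function of `G` with respect to `S`. -/
def groupGrowth (S : Set G) (R : ℕ) : ℕ := Nat.card (ballG S R)

/-- `L(g)`: the minimal size of a standard portrait `P_w` among words `w`
representing `g`. -/
def Lg (act : V → G → V) (S : Set G) (g : G) : ℕ :=
  sInf {m | ∃ w : List S, wordProd S w = g ∧ portraitCard act S w = m}

/-- `L(R)`: the maximum of `L(g)` over elements with `|g| ≤ R`. -/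
def LR (act : V → G → V) (S : Set G) (R : ℕ) : ℕ :=
  ⨆ g : ballG S R, Lg act S (g : G)

/-- `N_p(w)^p = Σ_{(B,x,y) ∈ P_w} (#B)^{p-1}`, the sum over the isomorphism
classes of the standard portrait of `w`. -/
def Npow (act : V → G → V) (S : Set G) (w : List S) (p : ℝ) : ℝ :=
  ∑' q : Quot (PortraitRel act S w),
    (Nat.card (ball act S (Quot.out q) (rad act S w (Quot.out q))) : ℝ) ^ (p - 1)

/-- `N_p(w) = (Σ_{(B,x,y) ∈ P_w} (#B)^{p-1})^{1/p}`. -/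
def Np (act : V → G → V) (S : Set G) (w : List S) (p : ℝ) : ℝ :=
  Npow act S w p ^ (1 / p)

/-- `N_p(g)`: the infimum of `N_p(w)` over words `w` representing `g`. -/
def Npg (act : V → G → V) (S : Set G) (g : G) (p : ℝ) : ℝ :=
  sInf {x : ℝ | ∃ w : List S, wordProd S w = g ∧ Np act S w p = x}

/-- `N_p(R)`: the maximum of `N_p(g)` over elements of length at most `R`. -/
def NpR (act : V → G → V) (S : Set G) (R : ℕ) (p : ℝ) : ℝ :=
  sSup {x : ℝ | ∃ g ∈ ballG S R, Npg act S g p = x}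


section WordCalculus

variable {act : V → G → V} {S : Set G}

theorem act_wordProd_append (hmul : ∀ (v : V) (g h : G), act (act v g) h = act v (g * h))
    (v : V) (a b : List S) :
    act v (wordProd S (a ++ b)) = act (act v (wordProd S a)) (wordProd S b) := by
  simp [wordProd, hmul]

theorem act_wordProd_concat (hmul : ∀ (v : V) (g h : G), act (act v g) h = act v (g * h))
    (v : V) (a : List S) (s : S) :
    act v (wordProd S (a ++ [s])) = act (act v (wordProd S a)) (s : G) := by
  rw [act_wordProd_append hmul]
  simp [wordProd]

theorem mem_ball_of_length_le (v : V) {a : List S} {r : ℕ} (ha : a.length ≤ r) :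
    act v (wordProd S a) ∈ ball act S v r :=
  ⟨a, ha, rfl⟩

theorem ball_mono (v : V) {r r' : ℕ} (h : r ≤ r') : ball act S v r ⊆ ball act S v r' := by
  rintro _ ⟨a, ha, rfl⟩
  exact ⟨a, ha.trans h, rfl⟩

/-- The path labeled `w` starting at `v` stays in the ball of radius `r` around `v`. -/
def StaysIn (act : V → G → V) (S : Set G) (r : ℕ) (v : V) (w : List S) : Prop :=
  ∀ p : List S, p <+: w → act v (wordProd S p) ∈ ball act S v r

theorem StaysIn.of_prefix {r : ℕ} {v : V} {w w' : List S} (h : StaysIn act S r v w)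
    (hw : w' <+: w) : StaysIn act S r v w' :=
  fun p hp => h p (hp.trans hw)

theorem staysIn_of_length_le {r : ℕ} (v : V) {w : List S} (hw : w.length ≤ r) :
    StaysIn act S r v w :=
  fun _ hp => mem_ball_of_length_le v (hp.length_le.trans hw)

theorem gdist_wordProd_le_iff (v : V) (a : List S) (r : ℕ) :
    gdist act S v (act v (wordProd S a)) ≤ r ↔ act v (wordProd S a) ∈ ball act S v r := by
  refine ⟨fun h => ball_mono v h ?_, fun h => Nat.sInf_le h⟩
  exact Nat.sInf_mem (s := {n | act v (wordProd S a) ∈ ball act S v n})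
    ⟨a.length, mem_ball_of_length_le v le_rfl⟩

theorem rad_le_iff (w : List S) (v : V) (r : ℕ) :
    rad act S w v ≤ r ↔ StaysIn act S r v w := by
  simp only [rad, Finset.sup_le_iff, Finset.mem_range, gdist_wordProd_le_iff]
  constructor
  · intro h p hp
    rw [List.prefix_iff_eq_take.1 hp]
    exact h _ (Nat.lt_succ_of_le hp.length_le)
  · exact fun h i _ => h _ (List.take_prefix i w)

theorem rad_le_length (w : List S) (v : V) : rad act S w v ≤ w.length :=
  (rad_le_iff w v _).2 (staysIn_of_length_le v le_rfl)

/-- The labeled balls of radius `r` around `v` and `u` satisfy the same coincidences between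
endpoints of short words; this amounts to the balls being isomorphic. -/
def WordEquiv (act : V → G → V) (S : Set G) (r : ℕ) (v u : V) : Prop :=
  ∀ a b : List S, a.length ≤ r + 1 → b.length ≤ r →
    (act v (wordProd S a) = act v (wordProd S b) ↔ act u (wordProd S a) = act u (wordProd S b))

theorem WordEquiv.refl (r : ℕ) (v : V) : WordEquiv act S r v v :=
  fun _ _ _ _ => Iff.rfl

theorem WordEquiv.symm {r : ℕ} {v u : V} (h : WordEquiv act S r v u) : WordEquiv act S r u v :=
  fun a b ha hb => (h a b ha hb).symm

theorem WordEquiv.trans {r : ℕ} {v u x : V} (h : WordEquiv act S r v u)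
    (h' : WordEquiv act S r u x) : WordEquiv act S r v x :=
  fun a b ha hb => (h a b ha hb).trans (h' a b ha hb)

theorem WordEquiv.mono {r r' : ℕ} {v u : V} (h : WordEquiv act S r v u) (hr : r' ≤ r) :
    WordEquiv act S r' v u :=
  fun a b ha hb => h a b (by lia) (hb.trans hr)

theorem wordEquiv_equivalence (r : ℕ) : Equivalence (WordEquiv act S r) :=
  ⟨WordEquiv.refl r, WordEquiv.symm, WordEquiv.trans⟩

theorem WordEquiv.act_eq (hmul : ∀ (v : V) (g h : G), act (act v g) h = act v (g * h))
    {r : ℕ} {v u : V} (h : WordEquiv act S r v u) {w : List S} (hw : StaysIn act S r v w)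
    {b : List S} (hb : b.length ≤ r) (hwb : act v (wordProd S w) = act v (wordProd S b)) :
    act u (wordProd S w) = act u (wordProd S b) := by
  induction w using List.reverseRecOn generalizing b with
  | nil => exact (h [] b (by simp) hb).1 hwb
  | append_singleton w s ih =>
    have hpre : w <+: w ++ [s] := List.prefix_append _ _
    obtain ⟨b', hb', hvb'⟩ := hw w hpre
    have hu := ih (hw.of_prefix hpre) hb' hvb'.symm
    rw [act_wordProd_concat hmul, hu, ← act_wordProd_concat hmul]
    refine (h (b' ++ [s]) b (by simpa using hb') hb).1 ?_
    rw [act_wordProd_concat hmul, hvb', ← act_wordProd_concat hmul, hwb]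

theorem WordEquiv.staysIn (hmul : ∀ (v : V) (g h : G), act (act v g) h = act v (g * h))
    {r : ℕ} {v u : V} (h : WordEquiv act S r v u) {w : List S} (hw : StaysIn act S r v w) :
    StaysIn act S r u w := by
  intro p hp
  obtain ⟨b, hb, hvb⟩ := hw p hp
  exact ⟨b, hb, (h.act_eq hmul (hw.of_prefix hp) hb hvb.symm).symm⟩

theorem WordEquiv.rad_le (hmul : ∀ (v : V) (g h : G), act (act v g) h = act v (g * h))
    {r : ℕ} {v u : V} (h : WordEquiv act S r v u) {w : List S} (hr : rad act S w v ≤ r) :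
    rad act S w u ≤ rad act S w v :=
  (rad_le_iff _ _ _).2 ((h.mono hr).staysIn hmul ((rad_le_iff _ _ _).1 le_rfl))

/-- A map preserving labeled edges of a ball carries paths inside that ball to paths. -/
theorem map_act_wordProd (hone : ∀ v : V, act v 1 = v)
    (hmul : ∀ (v : V) (g h : G), act (act v g) h = act v (g * h)) {r : ℕ} {v u : V}
    {φ : V → V} (hφ : φ v = u)
    (hedge : ∀ x ∈ ball act S v r, ∀ y ∈ ball act S v r, ∀ s : S,
      (act x (s : G) = y ↔ act (φ x) (s : G) = φ y))
    {w : List S} (hw : StaysIn act S r v w) :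
    φ (act v (wordProd S w)) = act u (wordProd S w) := by
  induction w using List.reverseRecOn with
  | nil => simpa [wordProd, hone] using hφ
  | append_singleton w s ih =>
    have hpre : w <+: w ++ [s] := List.prefix_append _ _
    rw [act_wordProd_concat hmul u, ← ih (hw.of_prefix hpre)]
    exact ((hedge _ (hw w hpre) _ (hw _ List.prefix_rfl) s).1
      (act_wordProd_concat hmul v w s).symm).symm

theorem wordEquiv_of_map (hone : ∀ v : V, act v 1 = v)
    (hmul : ∀ (v : V) (g h : G), act (act v g) h = act v (g * h)) {r : ℕ} {v u : V}
    {φ : V → V} (hφ : φ v = u) (hinj : Set.InjOn φ (ball act S v r))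
    (hedge : ∀ x ∈ ball act S v r, ∀ y ∈ ball act S v r, ∀ s : S,
      (act x (s : G) = y ↔ act (φ x) (s : G) = φ y)) :
    WordEquiv act S r v u := by
  have hmap : ∀ a : List S, a.length ≤ r → φ (act v (wordProd S a)) = act u (wordProd S a) :=
    fun a ha => map_act_wordProd hone hmul hφ hedge (staysIn_of_length_le v ha)
  intro a b ha hb
  induction a using List.reverseRecOn with
  | nil =>
    rw [← hmap [] (by simp), ← hmap b hb]
    exact (hinj.eq_iff (mem_ball_of_length_le v (by simp)) (mem_ball_of_length_le v hb)).symm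
  | append_singleton a s _ =>
    have ha' : a.length ≤ r := by simpa using ha
    rw [act_wordProd_concat hmul, act_wordProd_concat hmul, ← hmap a ha', ← hmap b hb]
    exact hedge _ (mem_ball_of_length_le v ha') _ (mem_ball_of_length_le v hb) s

theorem BallIso.wordEquiv (hone : ∀ v : V, act v 1 = v)
    (hmul : ∀ (v : V) (g h : G), act (act v g) h = act v (g * h)) {r : ℕ} {v u : V}
    (h : BallIso act S r v u) : WordEquiv act S r v u := by
  obtain ⟨φ, hbij, hφ, hedge⟩ := h
  exact wordEquiv_of_map hone hmul hφ hbij.injOn hedge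

theorem WordEquiv.exists_map (hone : ∀ v : V, act v 1 = v)
    (hmul : ∀ (v : V) (g h : G), act (act v g) h = act v (g * h)) {r : ℕ} {v u : V}
    (h : WordEquiv act S r v u) :
    ∃ φ : V → V, Set.BijOn φ (ball act S v r) (ball act S u r) ∧ φ v = u ∧
      ∀ x ∈ ball act S v r, ∀ y ∈ ball act S v r, ∀ s : S,
        (act x (s : G) = y ↔ act (φ x) (s : G) = φ y) := by
  have hex : ∀ x : V, ∃ a : List S, x ∈ ball act S v r →
      a.length ≤ r ∧ act v (wordProd S a) = x := fun x => by
    by_cases hx : x ∈ ball act S v r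
    · obtain ⟨a, ha⟩ := hx
      exact ⟨a, fun _ => ha⟩
    · exact ⟨[], fun hx' => absurd hx' hx⟩
  choose word hword using hex
  have hmap : ∀ a : List S, a.length ≤ r →
      act u (wordProd S (word (act v (wordProd S a)))) = act u (wordProd S a) := fun a ha => by
    obtain ⟨hl, he⟩ := hword _ (mem_ball_of_length_le v ha)
    exact (h _ _ (by lia) ha).1 he
  refine ⟨fun x => act u (wordProd S (word x)), ⟨?_, ?_, ?_⟩, ?_, ?_⟩
  · exact fun x hx => mem_ball_of_length_le u (hword x hx).1
  · intro x hx y hy hxy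
    obtain ⟨hx1, hx2⟩ := hword x hx
    obtain ⟨hy1, hy2⟩ := hword y hy
    rw [← hx2, ← hy2]
    exact (h _ _ (by lia) hy1).2 hxy
  · rintro _ ⟨a, ha, rfl⟩
    exact ⟨_, mem_ball_of_length_le v ha, hmap a ha⟩
  · simpa [wordProd, hone] using hmap [] (by simp)
  · rintro _ ⟨a, ha, rfl⟩ _ ⟨b, hb, rfl⟩ s
    simp only [hmap a ha, hmap b hb, ← act_wordProd_concat hmul]
    exact h _ _ (by simpa using ha) hb

theorem PortraitRel.rad_eq_and_wordEquiv (hone : ∀ v : V, act v 1 = v)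
    (hmul : ∀ (v : V) (g h : G), act (act v g) h = act v (g * h)) {w : List S} {v u : V}
    (h : PortraitRel act S w v u) :
    rad act S w v = rad act S w u ∧ WordEquiv act S (rad act S w v) v u := by
  obtain ⟨φ, hbij, hφ, -, hedge⟩ := h
  have hequiv := wordEquiv_of_map hone hmul hφ hbij.injOn hedge
  have hle : rad act S w u ≤ rad act S w v := hequiv.rad_le hmul le_rfl
  refine ⟨le_antisymm ?_ hle, hequiv⟩
  have hv : StaysIn act S (rad act S w v) v w := (rad_le_iff _ _ _).1 le_rfl
  have hu : StaysIn act S (rad act S w u) u w := (rad_le_iff _ _ _).1 le_rfl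
  refine (rad_le_iff _ _ _).2 fun p hp => ?_
  obtain ⟨b, hb, hub⟩ := hu p hp
  refine ⟨b, hb, hbij.injOn (mem_ball_of_length_le v (hb.trans hle)) (hv p hp) ?_⟩
  rw [map_act_wordProd hone hmul hφ hedge (staysIn_of_length_le v (hb.trans hle)), hub,
    map_act_wordProd hone hmul hφ hedge (hv.of_prefix hp)]

theorem WordEquiv.portraitRel (hone : ∀ v : V, act v 1 = v)
    (hmul : ∀ (v : V) (g h : G), act (act v g) h = act v (g * h)) {w : List S} {v u : V}
    (h : WordEquiv act S w.length v u) : PortraitRel act S w v u := by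
  have hv := rad_le_length (act := act) w v
  have hrad : rad act S w v = rad act S w u :=
    le_antisymm (h.symm.rad_le hmul (rad_le_length w u)) (h.rad_le hmul hv)
  obtain ⟨φ, hbij, hφ, hedge⟩ := (h.mono hv).exists_map hone hmul
  exact ⟨φ, hrad ▸ hbij, hφ,
    map_act_wordProd hone hmul hφ hedge ((rad_le_iff _ _ _).1 le_rfl), hedge⟩

theorem wordEquiv_of_mk_eq (hone : ∀ v : V, act v 1 = v)
    (hmul : ∀ (v : V) (g h : G), act (act v g) h = act v (g * h)) {r : ℕ} {v u : V}
    (h : Quot.mk (BallIso act S r) v = Quot.mk (BallIso act S r) u) :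
    WordEquiv act S r v u :=
  (wordEquiv_equivalence r).eqvGen_iff.1
    ((Quot.eqvGen_exact h).mono fun _ _ => BallIso.wordEquiv hone hmul)

theorem rad_eq_and_wordEquiv_of_mk_eq (hone : ∀ v : V, act v 1 = v)
    (hmul : ∀ (v : V) (g h : G), act (act v g) h = act v (g * h)) {w : List S} {v u : V}
    (h : Quot.mk (PortraitRel act S w) v = Quot.mk (PortraitRel act S w) u) :
    rad act S w v = rad act S w u ∧ WordEquiv act S (rad act S w v) v u := by
  have heq : Equivalence fun v u : V =>
      rad act S w v = rad act S w u ∧ WordEquiv act S (rad act S w v) v u :=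
    ⟨fun v => ⟨rfl, .refl _ _⟩, fun h => ⟨h.1.symm, h.1 ▸ h.2.symm⟩,
      fun h h' => ⟨h.1.trans h'.1, h.2.trans (h.1 ▸ h'.2)⟩⟩
  exact heq.eqvGen_iff.1
    ((Quot.eqvGen_exact h).mono fun _ _ => PortraitRel.rad_eq_and_wordEquiv hone hmul)

theorem finite_quot_of_wordEquiv [Finite S] (r : ℕ) {rel : V → V → Prop}
    (hrel : ∀ v u, WordEquiv act S r v u → rel v u) : Finite (Quot rel) := by
  have : Finite {a : List S | a.length ≤ r + 1} := List.finite_length_le S (r + 1)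
  have : Finite {a : List S | a.length ≤ r} := List.finite_length_le S r
  let coincidences (v : V) :
      Set ({a : List S | a.length ≤ r + 1} × {a : List S | a.length ≤ r}) :=
    {p | act v (wordProd S p.1) = act v (wordProd S p.2)}
  refine Finite.of_injective (fun q : Quot rel => coincidences q.out) fun q q' h => ?_
  rw [← q.out_eq, ← q'.out_eq]
  exact Quot.sound (hrel _ _ fun a b ha hb => Set.ext_iff.1 h (⟨a, ha⟩, ⟨b, hb⟩))

theorem finite_quot_ballIso [Finite S] (hone : ∀ v : V, act v 1 = v)
    (hmul : ∀ (v : V) (g h : G), act (act v g) h = act v (g * h)) (r : ℕ) :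
    Finite (Quot (BallIso act S r)) :=
  finite_quot_of_wordEquiv r fun _ _ h => h.exists_map hone hmul

theorem finite_quot_portraitRel [Finite S] (hone : ∀ v : V, act v 1 = v)
    (hmul : ∀ (v : V) (g h : G), act (act v g) h = act v (g * h)) (w : List S) :
    Finite (Quot (PortraitRel act S w)) :=
  finite_quot_of_wordEquiv w.length fun _ _ h => h.portraitRel hone hmul

theorem finite_ballG [Finite S] (R : ℕ) : (ballG S R).Finite :=
  (List.finite_length_le S R).image (wordProd S)

theorem finite_ball [Finite S] (v : V) (r : ℕ) : (ball act S v r).Finite :=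
  (List.finite_length_le S r).image _

theorem ncard_ball_le_graphGrowth [Finite S] (v : V) (r : ℕ) :
    (ball act S v r).ncard ≤ graphGrowth act S r := by
  refine le_ciSup (f := fun v => (ball act S v r).ncard)
    ⟨{a : List S | a.length ≤ r}.ncard, ?_⟩ v
  rintro _ ⟨v, rfl⟩
  exact Set.ncard_image_le (List.finite_length_le S r)

theorem Lg_le_LR [Finite S] {R : ℕ} {g : G} (hg : g ∈ ballG S R) :
    Lg act S g ≤ LR act S R := by
  have := (finite_ballG (S := S) R).to_subtype
  exact le_ciSup (f := fun g : ballG S R => Lg act S (g : G)) (Set.finite_range _).bddAbove ⟨g, hg⟩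

theorem exists_portraitCard_eq_Lg {R : ℕ} {g : G} (hg : g ∈ ballG S R) :
    ∃ w : List S, wordProd S w = g ∧ portraitCard act S w = Lg act S g := by
  obtain ⟨w, -, hw⟩ := hg
  exact Nat.sInf_mem (s := {m | ∃ w : List S, wordProd S w = g ∧ portraitCard act S w = m})
    ⟨_, w, hw, rfl⟩

end WordCalculus

section Counting

variable {act : V → G → V} {S : Set G}

/-- The triples `(r, x, y)` with `r ≤ R`, `x` the chosen representative of an isomorphism class of
balls of radius `r`, and `y` in the ball of radius `r` around `x`: representatives of all bi-rooted
balls of radius at most `R`. -/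
def birootedBalls (act : V → G → V) (S : Set G) (R : ℕ) : Set (ℕ × V × V) :=
  {t | t.1 ≤ R ∧ t.2.1 ∈ Set.range (Quot.out : Quot (BallIso act S t.1) → V) ∧
    t.2.2 ∈ ball act S t.2.1 t.1}

theorem birootedBalls_card_le [Finite S] (hone : ∀ v : V, act v 1 = v)
    (hmul : ∀ (v : V) (g h : G), act (act v g) h = act v (g * h)) {R D E : ℕ}
    (hD : ∀ r ≤ R, ballTypes act S r ≤ D) (hE : ∀ r ≤ R, graphGrowth act S r ≤ E) :
    (birootedBalls act S R).Finite ∧ (birootedBalls act S R).ncard ≤ (R + 1) * (D * E) := by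
  classical
  have hfin := finite_quot_ballIso (S := S) hone hmul
  have := fun r => Fintype.ofFinite (Quot (BallIso act S r))
  let T : Finset (ℕ × V × V) := (Finset.range (R + 1)).biUnion fun r =>
    (Finset.univ : Finset (Quot (BallIso act S r))).biUnion fun q =>
      (finite_ball (act := act) (S := S) q.out r).toFinset.image fun y => (r, q.out, y)
  have hT : birootedBalls act S R = T := by
    ext ⟨r, x, y⟩
    simp only [birootedBalls, T, Set.mem_ofPred_eq, Finset.mem_coe, Finset.mem_biUnion,
      Finset.mem_range, Finset.mem_image, Set.Finite.mem_toFinset, Finset.mem_univ,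
      Set.mem_range, true_and]
    constructor
    · rintro ⟨hr, ⟨q, rfl⟩, hy⟩
      exact ⟨r, by lia, q, y, hy, rfl⟩
    · rintro ⟨r', hr, q, y', hy, h⟩
      obtain ⟨rfl, rfl, rfl⟩ : r' = r ∧ q.out = x ∧ y' = y := by simpa using h
      exact ⟨by lia, ⟨q, rfl⟩, hy⟩
  refine ⟨hT ▸ T.finite_toSet, ?_⟩
  rw [hT, Set.ncard_coe_finset]
  refine (Finset.card_biUnion_le_card_mul _ _ (D * E) fun r hr => ?_).trans (by simp)
  have hr' : r ≤ R := by simpa [Nat.lt_succ_iff] using hr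
  refine (Finset.card_biUnion_le_card_mul _ _ E fun q _ => ?_).trans ?_
  · refine Finset.card_image_le.trans ?_
    rw [← Set.ncard_eq_toFinset_card _ (finite_ball _ _)]
    exact (ncard_ball_le_graphGrowth _ _).trans (hE r hr')
  · rw [Finset.card_univ, ← Nat.card_eq_fintype_card]
    exact Nat.mul_le_mul_right _ (hD r hr')

theorem groupGrowth_le_pow [Finite S] [Nonempty V] (hone : ∀ v : V, act v 1 = v)
    (hmul : ∀ (v : V) (g h : G), act (act v g) h = act v (g * h))
    (hfaithful : ∀ g : G, (∀ v : V, act v g = v) → g = 1) {R : ℕ}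
    (hfin : (birootedBalls act S R).Finite) :
    groupGrowth S R ≤ (birootedBalls act S R).ncard ^ LR act S R := by
  have hquot := finite_quot_portraitRel (S := S) hone hmul
  choose! w hw hwL using fun g (hg : g ∈ ballG S R) =>
    exists_portraitCard_eq_Lg (act := act) hg
  let rho (g : G) (v : V) : ℕ := min (rad act S (w g) v) R
  have hpath : ∀ g ∈ ballG S R, ∀ v : V, ∃ t : List S, wordProd S t = g ∧
      StaysIn act S (rho g v) v t := by
    intro g hg v
    rcases le_total (rad act S (w g) v) R with h | h
    · exact ⟨w g, hw g hg, (rad_le_iff _ _ _).1 (le_min le_rfl h)⟩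
    · obtain ⟨t, ht, rfl⟩ := hg
      exact ⟨t, rfl, staysIn_of_length_le v (ht.trans (le_min h le_rfl))⟩
  have hshort : ∀ g ∈ ballG S R, ∀ v : V, ∃ a : List S, a.length ≤ rho g v ∧
      act v (wordProd S a) = act v g := by
    intro g hg v
    obtain ⟨t, rfl, ht⟩ := hpath g hg v
    exact ht t List.prefix_rfl
  choose! a ha hag using hshort
  have htransport : ∀ g ∈ ballG S R, ∀ v u : V, WordEquiv act S (rho g v) v u →
      act u g = act u (wordProd S (a g v)) := by
    intro g hg v u h
    obtain ⟨t, htg, ht⟩ := hpath g hg v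
    have := h.act_eq hmul ht (ha g hg v) (by rw [htg, hag g hg])
    rwa [htg] at this
  let center (g : G) (v : V) : V := (Quot.mk (BallIso act S (rho g v)) v).out
  have hcenter : ∀ g v, WordEquiv act S (rho g v) (center g v) v := fun g v =>
    wordEquiv_of_mk_eq hone hmul (Quot.out_eq _)
  let code (g : ballG S R) (v : V) : birootedBalls act S R :=
    ⟨(rho g v, center g v, act (center g v) (wordProd S (a g v))),
      min_le_right _ _, ⟨_, rfl⟩, mem_ball_of_length_le _ (ha g g.2 v)⟩
  have henum : ∀ g : ballG S R, ∃ e : Fin (LR act S R) → Quot (PortraitRel act S (w g)),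
      Function.Surjective e := by
    intro g
    have : Nonempty (Quot (PortraitRel act S (w g))) := ⟨Quot.mk _ (Classical.arbitrary V)⟩
    have hle : Nat.card (Quot (PortraitRel act S (w g))) ≤ LR act S R :=
      (hwL g g.2).le.trans (Lg_le_LR g.2)
    exact ⟨_, (Function.invFun_surjective
      ((Fin.castLE_injective hle).comp (Finite.equivFin _).injective))⟩
  choose e he using henum
  have hinj : Function.Injective fun (g : ballG S R) (i : Fin (LR act S R)) =>
      code g (e g i).out := by
    intro g h hgh
    have key : ∀ v, act v g = act v h := by
      intro v
      obtain ⟨i, hi⟩ := he g (Quot.mk _ v)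
      set u := (e g i).out with hu
      set u' := (e h i).out
      obtain ⟨hrad, hvu⟩ := rad_eq_and_wordEquiv_of_mk_eq hone hmul
        (show Quot.mk (PortraitRel act S (w g)) u = Quot.mk _ v by rw [hu, Quot.out_eq, hi])
      have huv : WordEquiv act S (rho g u) u v := hvu.mono (min_le_left _ _)
      have hcode := congrArg Subtype.val (congrFun hgh i)
      obtain ⟨hrho, hcen, hend⟩ : rho g u = rho h u' ∧ center g u = center h u' ∧
          act (center g u) (wordProd S (a g u)) = act (center h u') (wordProd S (a h u')) := by
        simpa [code] using hcode
      have hxv : WordEquiv act S (rho g u) (center g u) v := (hcenter g u).trans huv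
      have hu'v : WordEquiv act S (rho h u') u' v := by
        rw [hcen, hrho] at hxv
        exact (hcenter h u').symm.trans hxv
      rw [htransport g g.2 u v huv, htransport h h.2 u' v hu'v]
      rw [← hcen] at hend
      exact (hxv _ _ ((ha g g.2 u).trans (Nat.le_succ _)) (hrho ▸ ha h h.2 u')).1 hend
    refine Subtype.ext (mul_inv_eq_one.1 (hfaithful _ fun v => ?_))
    rw [← hmul, key, hmul, mul_inv_cancel, hone]
  have := hfin.to_subtype
  have hcard := Nat.card_le_card_of_injective _ hinj
  rwa [Nat.card_fun, Nat.card_fin, Nat.card_coe_set_eq (birootedBalls act S R)] at hcard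

end Counting

/-- A sequence that is polynomially bounded from `1` on is bounded on initial segments by a fixed
power of the endpoint. -/
theorem exists_le_pow_of_le_rpow {f : ℕ → ℕ} {c k : ℝ}
    (hf : ∀ R : ℕ, 1 ≤ R → (f R : ℝ) ≤ c * (R : ℝ) ^ k) :
    ∃ m : ℕ, ∀ R : ℕ, 2 ≤ R → ∀ r ≤ R, f r ≤ R ^ m := by
  obtain ⟨K, hK⟩ := exists_nat_ge (max c (f 0))
  obtain ⟨n, hn⟩ := exists_nat_ge k
  refine ⟨K + n, fun R hR r hr => ?_⟩
  have hKR : K ≤ R ^ K := (Nat.lt_pow_self (by lia)).le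
  rcases Nat.eq_zero_or_pos r with rfl | hr0
  · have h0 : f 0 ≤ K := by exact_mod_cast (le_max_right _ _).trans hK
    exact (h0.trans hKR).trans (Nat.pow_le_pow_right (by lia) (by lia))
  · have hr1 : (1 : ℝ) ≤ r := by exact_mod_cast hr0
    have h1 : (f r : ℝ) ≤ K * (r : ℝ) ^ n := by
      refine (hf r hr0).trans ?_
      rw [← Real.rpow_natCast]
      exact mul_le_mul ((le_max_left _ _).trans hK) (Real.rpow_le_rpow_of_exponent_le hr1 hn)
        (by positivity) (by positivity)
    calc f r ≤ K * r ^ n := by exact_mod_cast h1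
      _ ≤ R ^ K * R ^ n := Nat.mul_le_mul hKR (Nat.pow_le_pow_left hr n)
      _ = R ^ (K + n) := (pow_add _ _ _).symm

/-- If `δ_Γ(R)` and `γ_Γ(R)` are bounded above by polynomial
functions of `R`, and `L(R) ≤ R^α` for some `α ∈ (0,1)`, then there is a constant
`C` such that `γ_G(R) ≤ exp(C · (log R) · R^α)` for all `R ≥ 2`. -/
theorem growth_subexp_of_poly_complexity
    (S : Set G) (hSfin : S.Finite) (hSsym : ∀ s ∈ S, s⁻¹ ∈ S)
    (hSgen : Subgroup.closure S = ⊤)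
    (act : V → G → V)
    (hact_one : ∀ v : V, act v 1 = v)
    (hact_mul : ∀ (v : V) (g h : G), act (act v g) h = act v (g * h))
    (hfaithful : ∀ g : G, (∀ v : V, act v g = v) → g = 1)
    (htrans : ∀ u v : V, ∃ g : G, act u g = v)
    -- polynomial upper bounds for `δ_Γ` and `γ_Γ`
    (c k : ℝ) (hpoly : ∀ R : ℕ, 1 ≤ R →
      (ballTypes act S R : ℝ) ≤ c * (R : ℝ) ^ k ∧
      (graphGrowth act S R : ℝ) ≤ c * (R : ℝ) ^ k)
    -- `L(R) ≤ R^α` for some `α ∈ (0,1)`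
    (α : ℝ) (hα0 : 0 < α) (hα1 : α < 1)
    (hLR : ∀ R : ℕ, 1 ≤ R → (LR act S R : ℝ) ≤ (R : ℝ) ^ α) :
    ∃ C : ℝ, ∀ R : ℕ, 2 ≤ R →
      (groupGrowth S R : ℝ) ≤ Real.exp (C * Real.log R * (R : ℝ) ^ α) := by
  have : Finite S := hSfin
  rcases isEmpty_or_nonempty V with hV | hV
  · have hsub : Subsingleton G := ⟨fun g h => by
      rw [hfaithful g fun v => hV.elim v, hfaithful h fun v => hV.elim v]⟩
    refine ⟨0, fun R _ => ?_⟩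
    have hcard : groupGrowth S R ≤ 1 := Finite.card_le_one_iff_subsingleton.2 inferInstance
    simpa using hcard
  obtain ⟨m, hm⟩ := exists_le_pow_of_le_rpow fun R hR => (hpoly R hR).1
  obtain ⟨n, hn⟩ := exists_le_pow_of_le_rpow fun R hR => (hpoly R hR).2
  refine ⟨2 + (m + n), fun R hR => ?_⟩
  obtain ⟨hfin, hcard⟩ := birootedBalls_card_le hact_one hact_mul (hm R hR) (hn R hR)
  have hcard' : (birootedBalls act S R).ncard ≤ R ^ (2 + (m + n)) := by
    refine hcard.trans ?_
    rw [pow_add, pow_add]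
    exact Nat.mul_le_mul_right _ (by nlinarith)
  have hgrowth : groupGrowth S R ≤ R ^ ((2 + (m + n)) * LR act S R) := by
    rw [pow_mul]
    exact (groupGrowth_le_pow hact_one hact_mul hfaithful hfin).trans
      (Nat.pow_le_pow_left hcard' _)
  have hRpos : (0 : ℝ) < R := by exact_mod_cast (by lia : 0 < R)
  have hlog : 0 ≤ Real.log R := Real.log_natCast_nonneg R
  calc (groupGrowth S R : ℝ) ≤ (R : ℝ) ^ ((2 + (m + n)) * LR act S R) := by exact_mod_cast hgrowth
    _ = Real.exp ((2 + (m + n)) * Real.log R * LR act S R) := by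
      rw [← Real.rpow_natCast, Real.rpow_def_of_pos hRpos]
      push_cast
      ring_nf
    _ ≤ Real.exp ((2 + (m + n)) * Real.log R * (R : ℝ) ^ α) := by
      gcongr
      exact hLR R (by lia)

end ActionGrowth
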